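/- Isolated spectral points of bounded-group generators are semisimple eigenvalues: Let A be the generator of a bounded C₀-group T with ‖T(t)‖ ≤ M, let μ be a real number such that iμ is an isolated point of σ(A), and let P := (1/(2πi)) ∮_{|λ−iμ|=r} (λ − A)⁻¹ dλ be the associated Riesz projection (r > 0 small enough that the closed disc of centre iμ and radius r meets σ(A) only at iμ). Then P(E) ⊆ D(A) and A(Px) = iμ·Px for every x ∈ E. -/

import Mathlib

open MeasureTheory Complex Filter Topology Metric

namespace SpectralDecomp

variable {G : Type*} [NormedAddCommGroup G] [NormedSpace ℂ G]

/-- `R` is the bounded inverse of `z • I - A`. -/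
structure ResolventAt (A : G →ₗ.[ℂ] G) (z : ℂ) (R : G →L[ℂ] G) : Prop where
  mem : ∀ y : G, R y ∈ A.domain
  solves : ∀ y : G, z • R y - A ⟨R y, mem y⟩ = y
  leftInv : ∀ x : A.domain, R (z • (x : G) - A x) = x

/-- The resolvent set of the (unbounded) operator `A`. -/
def resolventSet (A : G →ₗ.[ℂ] G) : Set ℂ :=
  {z : ℂ | ∃ R : G →L[ℂ] G, ResolventAt A z R}

/-- The spectrum of the (unbounded) operator `A`. -/
def spectrumSet (A : G →ₗ.[ℂ] G) : Set ℂ := (resolventSet A)ᶜ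

/-- Membership in the domain of `A ^ j`. -/
def InDomPow (A : G →ₗ.[ℂ] G) : ℕ → G → Prop
  | 0, _ => True
  | j + 1, x => ∃ h : x ∈ A.domain, InDomPow A j (A ⟨x, h⟩)

/-- The value `A ^ j x` for `x ∈ D(A ^ j)`. -/
noncomputable def powApply (A : G →ₗ.[ℂ] G) : (j : ℕ) → (x : G) → InDomPow A j x → G
  | 0, x, _ => x
  | j + 1, x, h => powApply A j (A ⟨x, h.choose⟩) h.choose_spec

/-- `A` generates an `n`-times integrated group `(Sp, Sm)` bounded by `M * (1 + |t| ^ m)`. -/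
def Generates (A : G →ₗ.[ℂ] G) (n m : ℕ) (M : ℝ) (Sp Sm : ℝ → G →L[ℂ] G) : Prop :=
  (∀ x : G, ContinuousOn (fun t : ℝ => Sp t x) (Set.Ici 0)) ∧
  (∀ x : G, ContinuousOn (fun t : ℝ => Sm t x) (Set.Ici 0)) ∧
  (∀ t : ℝ, 0 ≤ t → ‖Sp t‖ ≤ M * (1 + t ^ m)) ∧
  (∀ t : ℝ, 0 ≤ t → ‖Sm t‖ ≤ M * (1 + t ^ m)) ∧
  (∀ z : ℂ, 0 < z.re →
    (∃ R : G →L[ℂ] G, ResolventAt A z R ∧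
      ∀ x : G, R x = z ^ n • ∫ t in Set.Ioi (0 : ℝ), Complex.exp (-z * t) • Sp t x) ∧
    (∃ R : G →L[ℂ] G, ResolventAt A (-z) R ∧
      ∀ x : G, -(R x) = z ^ n • ∫ t in Set.Ioi (0 : ℝ), Complex.exp (-z * t) • Sm t x))

/-- The Riesz projection associated to the circle of centre `c` and radius `ρ`,
built from the resolvent function `Rres`. -/
noncomputable def rieszProj (Rres : ℂ → G →L[ℂ] G) (c : ℂ) (ρ : ℝ) : G →L[ℂ] G :=
  (2 * Real.pi * Complex.I)⁻¹ • (∮ z in C(c, ρ), Rres z)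

section Semigroup

variable {E : Type*} [NormedAddCommGroup E]

/-- A curve which tends to `0` at infinity and whose velocity decays exponentially
is bounded at time `0` by the integral of the bound on its velocity. -/
lemma norm_le_div_of_norm_deriv_le_exp [NormedSpace ℝ E] {φ φ' : ℝ → E} {a K : ℝ} (ha : 0 < a)
    (hφ : ∀ t, HasDerivAt φ (φ' t) t)
    (hφ' : ∀ t, 0 ≤ t → ‖φ' t‖ ≤ K * Real.exp (-(a * t)))
    (hlim : Tendsto φ atTop (𝓝 0)) : ‖φ 0‖ ≤ K / a := by
  have hK : 0 ≤ K := by simpa using (norm_nonneg _).trans (hφ' 0 le_rfl)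
  have hbound : ∀ t, 0 ≤ t → ‖φ t - φ 0‖ ≤ K / a := by
    intro t ht
    have hB : ∀ s, HasDerivAt (fun s : ℝ => K / a - K / a * Real.exp (-(a * s)))
        (K * Real.exp (-(a * s))) s := by
      intro s
      have h1 : HasDerivAt (fun s : ℝ => -(a * s)) (-(a * 1)) s :=
        ((hasDerivAt_id s).const_mul a).neg
      have h2 := (h1.exp.const_mul (K / a)).const_sub (K / a)
      refine h2.congr_deriv ?_
      field_simp
    have h := image_norm_le_of_norm_deriv_right_le_deriv_boundary (a := 0) (b := t)
      (f := fun s => φ s - φ 0) (f' := φ')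
      (fun s _ => ((hφ s).sub_const _).continuousAt.continuousWithinAt)
      (fun s _ => ((hφ s).sub_const _).hasDerivWithinAt)
      (by simp) hB (fun s hs => hφ' s hs.1) (Set.right_mem_Icc.2 ht)
    have : 0 ≤ K / a * Real.exp (-(a * t)) := by positivity
    linarith
  have h : Tendsto (fun t => ‖φ t - φ 0‖) atTop (𝓝 ‖0 - φ 0‖) := (hlim.sub_const _).norm
  rw [zero_sub, norm_neg] at h
  exact le_of_tendsto h ((eventually_ge_atTop 0).mono hbound)

variable [NormedSpace ℂ E] {T : ℝ → E →L[ℂ] E} {M : ℝ} {x y : E}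

/-- An orbit of a one-parameter group is differentiable if it is differentiable at `0`. -/
lemma hasDerivAt_orbit (hTmul : ∀ s t : ℝ, T (s + t) = T s ∘L T t)
    (hxy : Tendsto (fun t : ℝ => ((t : ℂ))⁻¹ • (T t x - x)) (𝓝[≠] 0) (𝓝 y)) (t : ℝ) :
    HasDerivAt (fun s => T s x) (T t y) t := by
  rw [hasDerivAt_iff_tendsto_slope_zero]
  refine (((T t).continuous.tendsto y).comp hxy).congr fun s => ?_
  simp only [Function.comp_apply, map_smul, map_sub, hTmul t s, ContinuousLinearMap.comp_apply]
  rw [← Complex.ofReal_inv, Complex.coe_smul]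

/-- The Hille–Yosida lower bound for `z - A`, for one half-plane at a time: the sign `σ = ±1`
selects the forward or the backward orbit. -/
lemma norm_le_div_norm_smul_sub (hT0 : T 0 = 1) (hTmul : ∀ s t : ℝ, T (s + t) = T s ∘L T t)
    (hTbd : ∀ t : ℝ, ‖T t‖ ≤ M)
    (hxy : Tendsto (fun t : ℝ => ((t : ℂ))⁻¹ • (T t x - x)) (𝓝[≠] 0) (𝓝 y))
    {z : ℂ} {σ : ℝ} (hσ : |σ| = 1) (hz : 0 < σ * z.re) :
    ‖x‖ ≤ M * ‖z • x - y‖ / (σ * z.re) := by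
  have hnorm : ∀ t : ℝ, ‖Complex.exp (-(z * (σ * t : ℝ)))‖ = Real.exp (-(σ * z.re * t)) := by
    intro t
    rw [Complex.norm_exp]
    congr 1
    simp
    ring
  have hderiv : ∀ t : ℝ, HasDerivAt
      (fun t : ℝ => Complex.exp (-(z * (σ * t : ℝ))) • T (σ * t) x)
      (-(σ : ℂ) • Complex.exp (-(z * (σ * t : ℝ))) • T (σ * t) (z • x - y)) t := by
    intro t
    have h1 : HasDerivAt (fun t : ℝ => σ * t) σ t := by
      simpa using (hasDerivAt_id t).const_mul σ
    have h2 := (hasDerivAt_orbit hTmul hxy (σ * t)).scomp t h1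
    have h3 := ((h1.ofReal_comp.const_mul z).neg).cexp
    have h4 := h3.smul h2
    refine h4.congr_deriv ?_
    simp only [map_sub, map_smul, Function.comp_apply, Pi.neg_apply, ← Complex.coe_smul]
    module
  have h := norm_le_div_of_norm_deriv_le_exp (K := M * ‖z • x - y‖) hz hderiv ?_ ?_
  · simpa [hT0] using h
  · intro t _
    rw [norm_smul, norm_smul, hnorm, norm_neg, Complex.norm_real, Real.norm_eq_abs, hσ, one_mul,
      mul_comm]
    gcongr
    exact (T (σ * t)).le_of_opNorm_le (hTbd _) _
  · have h0 : Tendsto (fun t : ℝ => Real.exp (-(σ * z.re * t)) * (M * ‖x‖)) atTop (𝓝 0) := by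
      rw [← zero_mul (M * ‖x‖)]
      exact (Real.tendsto_exp_neg_atTop_nhds_zero.comp
        (tendsto_id.const_mul_atTop hz)).mul_const _
    refine squeeze_zero_norm (fun t => ?_) h0
    rw [norm_smul, hnorm]
    gcongr
    exact (T (σ * t)).le_of_opNorm_le (hTbd _) _

end Semigroup

section Resolvent

variable {A : G →ₗ.[ℂ] G} {z w : ℂ} {R S : G →L[ℂ] G}

lemma ResolventAt.apply_eq (hR : ResolventAt A z R) (y : G) :
    A ⟨R y, hR.mem y⟩ = z • R y - y := by
  exact eq_sub_of_add_eq (sub_eq_iff_eq_add'.1 (hR.solves y)).symm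

/-- The first resolvent identity. -/
lemma ResolventAt.sub_eq (hR : ResolventAt A z R) (hS : ResolventAt A w S) :
    R - S = (w - z) • (R * S) := by
  ext y
  have h := hR.leftInv ⟨S y, hS.mem y⟩
  rw [hS.apply_eq] at h
  simp only [map_sub, map_smul] at h
  simp only [sub_apply, smul_apply,
    mul_apply_eq_comp]
  rw [← sub_eq_zero] at h ⊢
  rw [← h]
  module

/-- The resolvent is holomorphic on the resolvent set. -/
lemma differentiableOn_resolvent [CompleteSpace G] {Rres : ℂ → G →L[ℂ] G}
    (hres : ∀ z ∈ resolventSet A, ResolventAt A z (Rres z)) :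
    DifferentiableOn ℂ Rres (resolventSet A) := by
  intro z hz
  have hlin : Differentiable ℂ fun w : ℂ => 1 + (w - z) • Rres z := by fun_prop
  have hunit : IsUnit (1 + (z - z) • Rres z) := by simp
  have hinv : DifferentiableAt ℂ (fun w : ℂ => Rres z * Ring.inverse (1 + (w - z) • Rres z)) z :=
    ((differentiableAt_inverse hunit).comp z (hlin z)).const_mul _
  refine hinv.differentiableWithinAt.congr_of_eventuallyEq_of_mem ?_ hz
  have hev : ∀ᶠ w in 𝓝 z, IsUnit (1 + (w - z) • Rres z) :=
    hlin.continuous.continuousAt.eventually (Units.isOpen.mem_nhds hunit)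
  filter_upwards [self_mem_nhdsWithin, nhdsWithin_le_nhds hev] with w hw hu
  have h := (hres w hw).sub_eq (hres z hz)
  have h' : Rres w * (1 + (w - z) • Rres z) = Rres z := by
    rw [mul_add, mul_one, mul_smul_comm, ← sub_eq_zero]
    calc _ = (Rres w - Rres z) + (w - z) • (Rres w * Rres z) := by abel
      _ = 0 := by rw [h]; module
  nth_rewrite 1 [← h']
  rw [Ring.mul_inverse_cancel_right _ _ hu]

end Resolvent

/-- If `f` is holomorphic on a punctured closed disc centred on the imaginary axis and
`‖f z‖ * |Re z| ≤ M`, then the coefficient `∮ (z - c) f(z) dz` vanishes. -/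
lemma circleIntegral_sub_smul_eq_zero {F : Type*} [NormedAddCommGroup F] [NormedSpace ℂ F]
    [CompleteSpace F] {f : ℂ → F} {c : ℂ} {r M : ℝ} (hc : c.re = 0) (hr : 0 < r)
    (hf : DifferentiableOn ℂ f (closedBall c r \ {c}))
    (hM : ∀ z ∈ closedBall c r \ {c}, |z.re| * ‖f z‖ ≤ M) :
    (∮ z in C(c, r), (z - c) • f z) = 0 := by
  have hpow : ∀ n : ℕ, DifferentiableOn ℂ (fun z => (z - c) ^ n • f z) (closedBall c r \ {c}) :=
    fun n => DifferentiableOn.smul (by fun_prop) hf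
  have hsub : ∀ {ρ : ℝ}, 0 < ρ → ρ ≤ r → sphere c ρ ⊆ closedBall c r \ {c} := by
    intro ρ hρ hρr z hz
    refine ⟨closedBall_subset_closedBall hρr (sphere_subset_closedBall hz), ?_⟩
    rintro rfl
    simp [hρ.ne] at hz
  have hdeform : ∀ (n : ℕ) {ρ : ℝ}, 0 < ρ → ρ ≤ r →
      (∮ z in C(c, r), (z - c) ^ n • f z) = ∮ z in C(c, ρ), (z - c) ^ n • f z := by
    intro n ρ hρ hρr
    refine circleIntegral_eq_of_differentiable_on_annulus_off_countable hρ hρr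
      Set.countable_empty ((hpow n).continuousOn.mono ?_) ?_
    · rintro z ⟨hz, hz'⟩
      exact ⟨hz, fun h => hz' (by rw [Set.mem_singleton_iff.1 h]; exact mem_ball_self hρ)⟩
    · rintro z ⟨⟨hz, hz'⟩, -⟩
      refine (hpow n).differentiableAt (mem_of_superset
        ((isOpen_ball.sdiff isClosed_singleton).mem_nhds ⟨hz, ?_⟩)
        (Set.sdiff_subset_sdiff_left ball_subset_closedBall))
      exact fun h => hz' (by rw [Set.mem_singleton_iff.1 h]; exact mem_closedBall_self hρ.le)
  set N₁ := ∮ z in C(c, r), (z - c) ^ 1 • f z with hN₁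
  set N₃ := ∮ z in C(c, r), (z - c) ^ 3 • f z with hN₃
  have key : ∀ ρ : ℝ, 0 < ρ → ρ ≤ r → ‖N₃ + ((ρ : ℂ) ^ 2) • N₁‖ ≤ 4 * Real.pi * M * ρ ^ 3 := by
    intro ρ hρ hρr
    have hInt₃ : CircleIntegrable (fun z => (z - c) ^ 3 • f z) c ρ :=
      ((hpow 3).continuousOn.mono (hsub hρ hρr)).circleIntegrable hρ.le
    have hInt₁ : CircleIntegrable (fun z => ((ρ : ℂ) ^ 2) • (z - c) ^ 1 • f z) c ρ :=
      (((hpow 1).continuousOn.mono (hsub hρ hρr)).const_smul _).circleIntegrable hρ.le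
    have hsum : N₃ + ((ρ : ℂ) ^ 2) • N₁ =
        ∮ z in C(c, ρ), ((z - c) ^ 3 • f z + ((ρ : ℂ) ^ 2) • (z - c) ^ 1 • f z) := by
      rw [circleIntegral.integral_add hInt₃ hInt₁,
        circleIntegral.integral_smul, hN₁, hN₃, hdeform 1 hρ hρr, hdeform 3 hρ hρr]
    rw [hsum]
    refine (circleIntegral.norm_integral_le_of_norm_le_const hρ.le (C := 2 * M * ρ ^ 2)
      fun z hz => ?_).trans_eq (by ring)
    have hzρ : ‖z - c‖ = ρ := by simpa [dist_eq_norm] using hz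
    have hfac : (z - c) ^ 2 + (ρ : ℂ) ^ 2 = 2 * (z.re : ℂ) * (z - c) := by
      have hsq : (z - c).re ^ 2 + (z - c).im ^ 2 = ρ ^ 2 := by
        rw [← hzρ, ← Complex.normSq_eq_norm_sq, Complex.normSq_apply]; ring
      rw [← Complex.ofReal_pow, ← hsq]
      apply Complex.ext <;> simp [pow_two, hc] <;> ring
    have heq : (z - c) ^ 3 • f z + ((ρ : ℂ) ^ 2) • (z - c) ^ 1 • f z =
        (2 * (z.re : ℂ) * (z - c) ^ 2) • f z := by
      rw [smul_smul, ← add_smul]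
      congr 1
      linear_combination (z - c) * hfac
    rw [heq, norm_smul, norm_mul, norm_mul, norm_pow, hzρ, Complex.norm_real, Real.norm_eq_abs]
    have := mul_le_mul_of_nonneg_left (hM z (hsub hρ hρr hz)) (sq_nonneg ρ)
    simp only [Complex.norm_ofNat]
    linarith
  have hev : ∀ᶠ ρ : ℝ in 𝓝[>] 0, 0 < ρ ∧ ρ ≤ r := by
    filter_upwards [Ioc_mem_nhdsGT hr] with ρ hρ using hρ
  have hN₃0 : N₃ = 0 := by
    have h1 : Tendsto (fun ρ : ℝ => ‖N₃ + ((ρ : ℂ) ^ 2) • N₁‖) (𝓝[>] 0) (𝓝 ‖N₃‖) := by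
      have : Continuous fun ρ : ℝ => ‖N₃ + ((ρ : ℂ) ^ 2) • N₁‖ := by fun_prop
      simpa using (this.tendsto 0).mono_left nhdsWithin_le_nhds
    have h2 : Tendsto (fun ρ : ℝ => 4 * Real.pi * M * ρ ^ 3) (𝓝[>] 0) (𝓝 0) := by
      have : Continuous fun ρ : ℝ => 4 * Real.pi * M * ρ ^ 3 := by fun_prop
      simpa using (this.tendsto 0).mono_left nhdsWithin_le_nhds
    exact norm_le_zero_iff.1 (le_of_tendsto_of_tendsto h1 h2
      (hev.mono fun ρ hρ => key ρ hρ.1 hρ.2))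
  have hN₁0 : N₁ = 0 := by
    have h2 : Tendsto (fun ρ : ℝ => 4 * Real.pi * M * ρ) (𝓝[>] 0) (𝓝 0) := by
      have : Continuous fun ρ : ℝ => 4 * Real.pi * M * ρ := by fun_prop
      simpa using (this.tendsto 0).mono_left nhdsWithin_le_nhds
    refine norm_le_zero_iff.1 (ge_of_tendsto h2 (hev.mono fun ρ hρ => ?_))
    have h := key ρ hρ.1 hρ.2
    rw [hN₃0, zero_add, norm_smul, norm_pow, Complex.norm_real, Real.norm_eq_abs, sq_abs] at h
    refine le_of_mul_le_mul_left (h.trans_eq ?_) (pow_pos hρ.1 2)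
    ring
  simpa [hN₁] using hN₁0

/-- Isolated spectral points of bounded-group generators are semisimple
eigenvalues: if `A` generates the bounded `C₀`-group `T` with `‖T t‖ ≤ M`,
`μ` is real with `iμ` an isolated point of `σ(A)`, and `P` is the associated
Riesz projection, then `P(E) ⊆ D(A)` and `A (P x) = iμ • P x` for all `x`. -/
theorem rieszProj_semisimple_eigenvalue
    {E : Type*} [NormedAddCommGroup E] [NormedSpace ℂ E] [CompleteSpace E]
    (T : ℝ → E →L[ℂ] E) (M : ℝ)
    (hT0 : T 0 = 1) (hTmul : ∀ s t : ℝ, T (s + t) = T s ∘L T t)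
    (hTcont : ∀ x : E, Continuous fun t : ℝ => T t x)
    (hTbd : ∀ t : ℝ, ‖T t‖ ≤ M)
    (A : E →ₗ.[ℂ] E)
    (hgen : ∀ x y : E, (∃ hx : x ∈ A.domain, A ⟨x, hx⟩ = y) ↔
      Filter.Tendsto (fun t : ℝ => ((t : ℂ))⁻¹ • (T t x - x))
        (nhdsWithin 0 {(0 : ℝ)}ᶜ) (nhds y))
    (Rres : ℂ → E →L[ℂ] E)
    (hres : ∀ z ∈ resolventSet A, ResolventAt A z (Rres z))
    (μ : ℝ) (hμspec : (Complex.I * (μ : ℂ)) ∈ spectrumSet A)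
    (r : ℝ) (hr : 0 < r)
    (hrsep : ∀ z ∈ spectrumSet A,
      z ∈ Metric.closedBall (Complex.I * (μ : ℂ)) r → z = Complex.I * (μ : ℂ)) :
    ∀ x : E, ∃ hmem : rieszProj Rres (Complex.I * (μ : ℂ)) r x ∈ A.domain,
      A ⟨rieszProj Rres (Complex.I * (μ : ℂ)) r x, hmem⟩ =
        (Complex.I * (μ : ℂ)) • rieszProj Rres (Complex.I * (μ : ℂ)) r x := by
  set c : ℂ := Complex.I * (μ : ℂ) with hc
  have hcre : c.re = 0 := by simp [hc]
  have hsub : closedBall c r \ {c} ⊆ resolventSet A := by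
    rintro z ⟨hz, hzc⟩
    by_contra h
    exact hzc (hrsep z h hz)
  have hdiff : DifferentiableOn ℂ Rres (closedBall c r \ {c}) :=
    (differentiableOn_resolvent hres).mono hsub
  have hM : 0 ≤ M := (norm_nonneg _).trans (hTbd 0)
  have hbound : ∀ z ∈ closedBall c r \ {c}, |z.re| * ‖Rres z‖ ≤ M := by
    intro z hz
    have hR := hres z (hsub hz)
    rcases eq_or_ne z.re 0 with h0 | h0
    · simpa [h0] using hM
    have hpos : 0 < |z.re| := abs_pos.2 h0
    rw [mul_comm, ← le_div_iff₀ hpos]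
    refine ContinuousLinearMap.opNorm_le_bound _ (by positivity) fun y => ?_
    have hlim := (hgen _ _).1 ⟨hR.mem y, hR.apply_eq y⟩
    obtain ⟨σ, hσ, hσz⟩ : ∃ σ : ℝ, |σ| = 1 ∧ σ * z.re = |z.re| := by
      rcases lt_or_gt_of_ne h0 with h | h
      · exact ⟨-1, by simp, by rw [abs_of_neg h]; ring⟩
      · exact ⟨1, by simp, by rw [abs_of_pos h]; ring⟩
    have h := norm_le_div_norm_smul_sub hT0 hTmul hTbd hlim hσ (hσz ▸ hpos)
    rwa [hσz, sub_sub_cancel, mul_div_right_comm] at h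
  have hN := circleIntegral_sub_smul_eq_zero hcre hr hdiff hbound
  have hsphere : sphere c r ⊆ closedBall c r \ {c} := by
    intro z hz
    refine ⟨sphere_subset_closedBall hz, ?_⟩
    rintro rfl
    simp [hr.ne] at hz
  obtain ⟨w, hw⟩ : (sphere c r).Nonempty := NormedSpace.sphere_nonempty.2 hr.le
  have hRw := hres w (hsub (hsphere hw))
  have hcont : ContinuousOn Rres (sphere c r) := hdiff.continuousOn.mono hsphere
  have hresInt : CircleIntegrable Rres c r := hcont.circleIntegrable hr.le
  have hweighted : CircleIntegrable (fun z => (z - c) • Rres z) c r :=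
    ContinuousOn.circleIntegrable hr.le
      ((continuous_id.sub continuous_const).continuousOn.smul hcont)
  have hmul : ∀ {f : ℂ → E →L[ℂ] E}, CircleIntegrable f c r →
      (∮ z in C(c, r), Rres w * f z) = Rres w * ∮ z in C(c, r), f z := by
    intro f hf
    have h := (ContinuousLinearMap.mul ℂ (E →L[ℂ] E) (Rres w)).intervalIntegral_comp_comm hf.out
    simpa [circleIntegral] using h
  have hfix : (w - c) • (Rres w * ∮ z in C(c, r), Rres z) = ∮ z in C(c, r), Rres z := by
    have hconst : (∮ _z in C(c, r), Rres w) = 0 :=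
      circleIntegral_eq_zero_of_differentiable_on_off_countable hr.le Set.countable_empty
        continuousOn_const fun z _ => differentiableAt_const _
    have hsubInt : CircleIntegrable (fun z => Rres z - Rres w) c r :=
      hresInt.sub (circleIntegrable_const _ _ _)
    have hprodInt : CircleIntegrable (fun z => Rres w * ((z - c) • Rres z)) c r :=
      ContinuousOn.circleIntegrable hr.le
        (continuousOn_const.mul ((continuous_id.sub continuous_const).continuousOn.smul hcont))
    calc (w - c) • (Rres w * ∮ z in C(c, r), Rres z)
        = ∮ z in C(c, r), (w - c) • (Rres w * Rres z) := by
          rw [circleIntegral.integral_smul, hmul hresInt]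
      _ = ∮ z in C(c, r), (Rres z - Rres w + Rres w * ((z - c) • Rres z)) := by
          refine circleIntegral.integral_congr hr.le fun z hz => ?_
          have h := hRw.sub_eq (hres z (hsub (hsphere hz)))
          have h' : Rres z - Rres w = (w - z) • (Rres w * Rres z) := by
            rw [← neg_sub, h]; module
          simp only [h', mul_smul_comm]
          module
      _ = ∮ z in C(c, r), Rres z := by
          rw [circleIntegral.integral_add hsubInt hprodInt,
            circleIntegral.integral_sub hresInt (circleIntegrable_const _ _ _), hmul hweighted,
            hN, hconst]
          simp
  intro x
  set p := rieszProj Rres c r x with hp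
  have hpfix : Rres w ((w - c) • p) = p := by
    have h := congrArg (fun L : E →L[ℂ] E => (2 * Real.pi * Complex.I)⁻¹ • L x) hfix
    simp only [smul_apply, mul_apply_eq_comp] at h
    simp only [hp, rieszProj, smul_apply, map_smul]
    rw [← h, smul_comm]
  have hA := (hgen _ _).1 ⟨hRw.mem _, hRw.apply_eq ((w - c) • p)⟩
  rw [hpfix, show w • p - (w - c) • p = c • p by module] at hA
  exact (hgen _ _).2 hA

end SpectralDecomp
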